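/- arXiv:1105.0796 — 9 statements merged into one kernel-verified Lean document; each statement's English description precedes it below -/
import Mathlib

section
/- Let G be a (v,k,λ,μ)-strongly regular graph with v ≤ 2k − λ + 2. Then every good disconnecting set S of G satisfies |S| ≥ 2k − λ − 2. -/
namespace Brouwer

/-- `N(A)`: the set of vertices outside `A` adjacent to at least one vertex of `A`. -/
def setNeighbors {V : Type*} (G : SimpleGraph V) (A : Set V) : Set V :=
  {v | v ∉ A ∧ ∃ a ∈ A, G.Adj v a}

/-- A set `S` of vertices is a *good disconnecting set* if the induced subgraph of `G` on the
complement of `S` is disconnected and every connected component of that induced subgraph has at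
least two vertices. -/
def IsGoodDisconnectingSet {V : Type*} (G : SimpleGraph V) (S : Set V) : Prop :=
  (∃ u v : ↑(Sᶜ), ¬ (G.induce Sᶜ).Reachable u v) ∧
  (∀ v : ↑(Sᶜ), ∃ w : ↑(Sᶜ), w ≠ v ∧ (G.induce Sᶜ).Reachable v w)

/-- A vertex that reaches some other vertex has a neighbour. -/
lemma exists_adj_of_reachable {W : Type*} {H : SimpleGraph W} {v w : W} (hne : w ≠ v)
    (h : H.Reachable v w) : ∃ x, H.Adj v x := by
  obtain ⟨p⟩ := h
  cases p with
  | nil => exact absurd rfl hne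
  | cons hadj _ => exact ⟨_, hadj⟩

/-- If `G` is a `(v,k,λ,μ)`-strongly regular graph with `v ≤ 2k − λ + 2`, then every good
disconnecting set `S` of `G` satisfies `|S| ≥ 2k − λ − 2`. -/
theorem brouwer_statement_0 {V : Type*} [Fintype V] (G : SimpleGraph V) [DecidableRel G.Adj]
    (v k lam mu : ℕ) (hG : G.IsSRGWith v k lam mu)
    (hv : (v : ℤ) ≤ 2 * k - lam + 2)
    (S : Set V) (hS : IsGoodDisconnectingSet G S) :
    2 * (k : ℤ) - lam - 2 ≤ S.ncard := by
  classical
  obtain ⟨⟨a, b, hab⟩, hS⟩ := hS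
  have exists_nbr (x : ↑(Sᶜ)) : ∃ y, (G.induce Sᶜ).Adj x y :=
    let ⟨_, hne, hr⟩ := hS x
    exists_adj_of_reachable hne hr
  obtain ⟨a', ha⟩ := exists_nbr a
  obtain ⟨b', hb⟩ := exists_nbr b
  have card_nbrs {x y : ↑(Sᶜ)} (h : (G.induce Sᶜ).Adj x y) :
      (G.neighborFinset (x : V) ∪ G.neighborFinset (y : V)).card = 2 * k - lam :=
    hG.card_neighborFinset_union_of_adj h
  let far (x y : ↑(Sᶜ)) : Finset V := (G.neighborFinset x ∪ G.neighborFinset y)ᶜ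
  have card_far {x y : ↑(Sᶜ)} (h : (G.induce Sᶜ).Adj x y) : (far x y).card = v - (2 * k - lam) := by
    rw [Finset.card_compl, card_nbrs h, hG.card]
  have mem_far {x y w : ↑(Sᶜ)} (h : (G.induce Sᶜ).Adj x y)
      (hw : ¬ (G.induce Sᶜ).Reachable x w) : (w : V) ∈ far x y := by
    simp only [far, Finset.mem_compl, Finset.mem_union, SimpleGraph.mem_neighborFinset, not_or]
    refine ⟨fun hxw => hw (SimpleGraph.Adj.reachable hxw), fun hyw => hw (h.reachable.trans ?_)⟩
    exact SimpleGraph.Adj.reachable (G := G.induce Sᶜ) hyw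
  have hsub : Sᶜ ⊆ (↑(far a a' ∪ far b b') : Set V) := by
    intro w hw
    rw [Finset.mem_coe, Finset.mem_union]
    by_cases h : (G.induce Sᶜ).Reachable a ⟨w, hw⟩
    · exact .inr (mem_far hb fun h' => hab (h.trans h'.symm))
    · exact .inl (mem_far ha h)
  have hcard := Set.ncard_le_ncard hsub
  rw [Set.ncard_coe_finset] at hcard
  have hunion := Finset.card_union_le (far a a') (far b b')
  rw [card_far ha, card_far hb] at hunion
  have hle : 2 * k - lam ≤ v := by
    rw [← card_nbrs ha, ← hG.card]
    exact Finset.card_le_univ _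
  have htotal := Set.ncard_add_ncard_compl S
  rw [Nat.card_eq_fintype_card, hG.card] at htotal
  omega

end Brouwer
end

section
/- Let G be a connected non-complete (v,k,λ,μ)-strongly regular graph and suppose its vertex set is partitioned into three pairwise disjoint sets A, S, B with A and B nonempty and with no edge of G joining a vertex of A to a vertex of B. Then ((λ − μ)² + 4(k − μ)) · |S| ≥ 4 · |A| · |B| · μ. -/
namespace Brouwer

open Matrix

/-- The square of the shifted adjacency matrix `2A - (λ - μ)` of a strongly regular graph acts on
vectors as the scalar `(λ - μ)² + 4(k - μ)` plus `4μ` times the all-ones matrix. -/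
theorem _root_.SimpleGraph.IsSRGWith.shifted_mulVec_mulVec {V : Type*} [Fintype V] [DecidableEq V]
    {G : SimpleGraph V} [DecidableRel G.Adj] {n k l m : ℕ} (hG : G.IsSRGWith n k l m)
    (f : V → ℤ) (x : V) :
    (((2 : ℤ) • G.adjMatrix ℤ - ((l : ℤ) - m) • 1) *ᵥ
        (((2 : ℤ) • G.adjMatrix ℤ - ((l : ℤ) - m) • 1) *ᵥ f)) x =
      (((l : ℤ) - m) ^ 2 + 4 * ((k : ℤ) - m)) * f x + 4 * m * ∑ i, f i := by
  have h1 := hG.matrix_eq (α := ℤ)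
  have h2 : (1 : Matrix V V ℤ) + G.adjMatrix ℤ + Gᶜ.adjMatrix ℤ = Matrix.of fun _ _ => 1 :=
    by
    ext i j
    obtain rfl | hij := eq_or_ne i j
    · simp
    · by_cases h : G.Adj i j <;> simp [hij, h]
  have h3 : ((2 : ℤ) • G.adjMatrix ℤ - ((l : ℤ) - m) • 1) *
      ((2 : ℤ) • G.adjMatrix ℤ - ((l : ℤ) - m) • 1) =
      (((l : ℤ) - m) ^ 2 + 4 * ((k : ℤ) - m)) • (1 : Matrix V V ℤ) +
        (4 * (m : ℤ)) • Matrix.of fun _ _ => 1 := by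
    have e : ((2 : ℤ) • G.adjMatrix ℤ - ((l : ℤ) - m) • 1) *
      ((2 : ℤ) • G.adjMatrix ℤ - ((l : ℤ) - m) • 1) = (4 : ℤ) • G.adjMatrix ℤ ^ 2
        - (4 * ((l : ℤ) - m)) • G.adjMatrix ℤ + ((l : ℤ) - m) ^ 2 • 1 := by
      simp only [sub_mul, mul_sub, smul_mul_assoc, mul_smul_comm, mul_one, one_mul, pow_two]
      module
    rw [e, h1, ← h2]
    module
  rw [mulVec_mulVec, h3]
  rw [add_mulVec, smul_mulVec, smul_mulVec, one_mulVec]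
  simp [mulVec, dotProduct]

/-- The matrix `2A - t` of a `k`-regular graph has constant vectors as eigenvectors, with
eigenvalue `2k - t`. -/
theorem _root_.SimpleGraph.IsRegularOfDegree.shifted_mulVec_const {V : Type*} [Fintype V]
    [DecidableEq V] {G : SimpleGraph V} [DecidableRel G.Adj] {k : ℕ}
    (hG : G.IsRegularOfDegree k) (t c : ℤ) :
    ((2 : ℤ) • G.adjMatrix ℤ - t • 1) *ᵥ (fun _ => c) = fun _ => (2 * (k : ℤ) - t) * c := by
  ext y
  rw [sub_mulVec, smul_mulVec, smul_mulVec, one_mulVec, Pi.sub_apply, Pi.smul_apply,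
    SimpleGraph.adjMatrix_mulVec_apply]
  simp [hG y]
  ring

/-- In a strongly regular graph, `(2k - (λ - μ))² = (λ - μ)² + 4(k - μ) + 4μv`. -/
theorem _root_.SimpleGraph.IsSRGWith.shifted_degree_sq {V : Type*} [Fintype V] [Nonempty V]
    {G : SimpleGraph V} [DecidableRel G.Adj] {n k l m : ℕ} (hG : G.IsSRGWith n k l m) :
    (2 * (k : ℤ) - ((l : ℤ) - m)) ^ 2 = ((l : ℤ) - m) ^ 2 + 4 * ((k : ℤ) - m) + 4 * m * n := by
  classical
  obtain ⟨x⟩ := ‹Nonempty V›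
  have h := hG.shifted_mulVec_mulVec (fun _ => 1) x
  rw [hG.regular.shifted_mulVec_const, hG.regular.shifted_mulVec_const] at h
  simp [hG.card] at h
  linarith

/-- Haemers' separation bound for strongly regular graphs. -/
theorem _root_.SimpleGraph.IsSRGWith.card_mul_card_mul_le_of_forall_not_adj
    {V : Type*} [Fintype V]
    {G : SimpleGraph V} [DecidableRel G.Adj] {n k l m : ℕ} (hG : G.IsSRGWith n k l m)
    {A B : Finset V} (hA : A.Nonempty) (hB : B.Nonempty) (hAB : Disjoint A B)
    (hsep : ∀ a ∈ A, ∀ b ∈ B, ¬ G.Adj a b) :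
    (A.card : ℤ) * B.card * (2 * (k : ℤ) - ((l : ℤ) - m)) ^ 2 ≤
      (((l : ℤ) - m) ^ 2 + 4 * ((k : ℤ) - m)) * ((n - A.card) * (n - B.card)) := by
  classical
  let N : Matrix V V ℤ := (2 : ℤ) • G.adjMatrix ℤ - ((l : ℤ) - m) • 1
  let c : Finset V → V → ℤ := fun T x => n * (if x ∈ T then 1 else 0) - T.card
  have hNT : Nᵀ = N := by
    rw [transpose_sub, transpose_smul, transpose_smul, transpose_one,
      SimpleGraph.transpose_adjMatrix]
  have hsum (T : Finset V) : ∑ i, c T i = 0 := by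
    simp [c, Finset.sum_sub_distrib, hG.card, mul_comm]
  have hdot (T : Finset V) : ∑ i, c T i ^ 2 = n * T.card * (n - T.card) := by
    have (i : V) : c T i ^ 2 =
        (n ^ 2 - 2 * n * T.card) * (if i ∈ T then 1 else 0) + (T.card : ℤ) ^ 2 := by
      simp only [c]; split_ifs <;> ring
    simp_rw [this, Finset.sum_add_distrib, ← Finset.mul_sum]
    simp [hG.card]
    ring
  have hnorm : ∑ i, (N *ᵥ c B) i ^ 2 =
      (((l : ℤ) - m) ^ 2 + 4 * ((k : ℤ) - m)) * ∑ i, c B i ^ 2 := by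
    calc ∑ i, (N *ᵥ c B) i ^ 2 = (N *ᵥ c B) ⬝ᵥ (N *ᵥ c B) := by simp [dotProduct, pow_two]
      _ = c B ⬝ᵥ (N *ᵥ (N *ᵥ c B)) := by
        rw [dotProduct_mulVec, ← mulVec_transpose, hNT, dotProduct_comm]
      _ = _ := by
        simp only [dotProduct, N, hG.shifted_mulVec_mulVec, hsum, Finset.mul_sum]
        exact Finset.sum_congr rfl fun _ _ => by ring
  have hval (x : V) (hx : x ∈ A) :
      (N *ᵥ c B) x = -(B.card * (2 * (k : ℤ) - ((l : ℤ) - m))) := by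
    have hxB : x ∉ B := Finset.disjoint_left.mp hAB hx
    have : ∑ u ∈ G.neighborFinset x, c B u = -(k * B.card) := by
      rw [Finset.sum_congr rfl (g := fun _ => -(B.card : ℤ))]
      · simp [hG.regular x]
      · intro u hu
        have : u ∉ B := fun h => hsep x hx u h (by simpa using hu)
        simp [c, this]
    simp only [N, sub_mulVec, smul_mulVec, one_mulVec, Pi.sub_apply, Pi.smul_apply,
      SimpleGraph.adjMatrix_mulVec_apply, this, smul_eq_mul]
    simp [c, hxB]
    ring
  have hNsum : ∑ i, (N *ᵥ c B) i = 0 := by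
    have h1 : (fun _ : V => (1 : ℤ)) ⬝ᵥ (N *ᵥ c B) =
        (2 * (k : ℤ) - ((l : ℤ) - m)) * ∑ i, c B i := by
      rw [dotProduct_mulVec, ← mulVec_transpose, hNT, hG.regular.shifted_mulVec_const]
      simp [dotProduct, Finset.mul_sum]
    simpa [dotProduct, hsum] using h1
  have hcross : ∑ i, c A i * (N *ᵥ c B) i =
      -(n * A.card * B.card * (2 * (k : ℤ) - ((l : ℤ) - m))) := by
    have (i : V) : c A i * (N *ᵥ c B) i =
        n * (if i ∈ A then (N *ᵥ c B) i else 0) - A.card * (N *ᵥ c B) i := by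
      simp only [c]; split_ifs <;> ring
    simp_rw [this, Finset.sum_sub_distrib, ← Finset.mul_sum, hNsum]
    rw [← Finset.sum_filter, Finset.filter_mem_eq_inter, Finset.univ_inter,
      Finset.sum_congr rfl hval]
    simp
    ring
  have hcs := Finset.sum_mul_sq_le_sq_mul_sq Finset.univ (c A) (N *ᵥ c B)
  rw [hcross, hnorm, hdot, hdot] at hcs
  have hn : 0 < n := by
    rw [← hG.card]
    exact Fintype.card_pos_iff.mpr ⟨hA.choose⟩
  have hpos : (0 : ℤ) < n ^ 2 * (A.card * B.card) := by
    have := hA.card_pos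
    have := hB.card_pos
    positivity
  refine le_of_mul_le_mul_left ?_ hpos
  linarith

/-- If the vertex set of a connected non-complete `(v,k,λ,μ)`-strongly regular graph is
partitioned into pairwise disjoint sets `A`, `S`, `B` with `A`, `B` nonempty and no edge from
`A` to `B`, then `((λ − μ)² + 4(k − μ)) · |S| ≥ 4 · |A| · |B| · μ`. -/
theorem brouwer_statement_1 {V : Type*} [Fintype V] (G : SimpleGraph V) [DecidableRel G.Adj]
    (v k lam mu : ℕ) (hG : G.IsSRGWith v k lam mu)
    (hconn : G.Connected) (hnc : G ≠ ⊤)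
    (A S B : Set V)
    (hAS : Disjoint A S) (hAB : Disjoint A B) (hSB : Disjoint S B)
    (hcover : A ∪ S ∪ B = Set.univ)
    (hA : A.Nonempty) (hB : B.Nonempty)
    (hsep : ∀ a ∈ A, ∀ b ∈ B, ¬ G.Adj a b) :
    4 * (A.ncard : ℤ) * B.ncard * mu ≤ (((lam : ℤ) - mu) ^ 2 + 4 * ((k : ℤ) - mu)) * S.ncard := by
  classical
  have : Nonempty V := hA.to_subtype.map Subtype.val
  have hv : (0 : ℤ) < v := by
    rw [← hG.card]
    exact_mod_cast Fintype.card_pos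
  have hcard : (A.ncard : ℤ) + S.ncard + B.ncard = v := by
    rw [← hG.card, ← Nat.card_eq_fintype_card, ← Set.ncard_univ, ← hcover,
      Set.ncard_union_eq (Set.disjoint_union_left.mpr ⟨hAB, hSB⟩), Set.ncard_union_eq hAS]
    push_cast
    ring
  have h := hG.card_mul_card_mul_le_of_forall_not_adj (A := A.toFinset) (B := B.toFinset)
    (by simpa) (by simpa) (by simpa) (by simpa)
  rw [← Set.ncard_eq_toFinset_card', ← Set.ncard_eq_toFinset_card', hG.shifted_degree_sq] at h
  refine le_of_mul_le_mul_left ?_ hv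
  have hprod : ((v : ℤ) - A.ncard) * (v - B.ncard) = A.ncard * B.ncard + v * S.ncard := by
    rw [← hcard]
    ring
  rw [hprod] at h
  linarith

end Brouwer
end

section
/- Let G be a connected non-complete (v,k,λ,μ)-strongly regular graph satisfying the integer inequality 4(k − 2λ)(k − μ) > (λ − μ)²(2k − λ − 3). Then every good disconnecting set S of G satisfies |S| ≥ 2k − λ − 2. -/
namespace Brouwer

open Matrix Finset

section SRG

variable {V : Type*} [DecidableEq V] (G : SimpleGraph V) [DecidableRel G.Adj]

/-- The shifted adjacency matrix `2A - d`. For a strongly regular graph and `d = λ - μ`, its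
restriction to the orthogonal complement of the all-ones vector is a multiple of an isometry. -/
def shiftedAdjMatrix (d : ℤ) : Matrix V V ℤ := (2 : ℤ) • G.adjMatrix ℤ - d • 1

lemma shiftedAdjMatrix_transpose (d : ℤ) : (shiftedAdjMatrix G d)ᵀ = shiftedAdjMatrix G d := by
  rw [shiftedAdjMatrix, transpose_sub, transpose_smul, transpose_smul, transpose_one,
    SimpleGraph.transpose_adjMatrix]

lemma shiftedAdjMatrix_apply_of_ne_of_not_adj (d : ℤ) {x y : V} (hne : x ≠ y) (h : ¬ G.Adj x y) :
    shiftedAdjMatrix G d x y = 0 := by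
  rw [shiftedAdjMatrix, Matrix.sub_apply, Matrix.smul_apply, Matrix.smul_apply,
    SimpleGraph.adjMatrix_apply, if_neg h, one_apply_ne hne]
  simp

variable {G} [Fintype V] {v k lam mu : ℕ}

lemma shiftedAdjMatrix_mul_self (hG : G.IsSRGWith v k lam mu) :
    shiftedAdjMatrix G (lam - mu) * shiftedAdjMatrix G (lam - mu) =
      (((lam : ℤ) - mu) ^ 2 + 4 * (k - mu)) • 1 + (4 * mu : ℤ) • of 1 := by
  have h1 := hG.matrix_eq (α := ℤ)
  rw [← G.compl_adjMatrix_eq_adjMatrix_compl ℤ] at h1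
  have h2 := G.one_add_adjMatrix_add_compl_adjMatrix_eq_of_one (α := ℤ)
  rw [← h2]
  have h3 : shiftedAdjMatrix G (lam - mu) * shiftedAdjMatrix G (lam - mu) =
      (4 : ℤ) • G.adjMatrix ℤ ^ 2 - (4 * (lam - mu) : ℤ) • G.adjMatrix ℤ
        + ((lam - mu) ^ 2 : ℤ) • 1 := by
    simp only [shiftedAdjMatrix, sub_mul, mul_sub, smul_mul_assoc, mul_smul_comm, one_mul,
      mul_one, sq]
    module
  rw [h3, h1]
  module

lemma shiftedAdjMatrix_mulVec_one (hG : G.IsSRGWith v k lam mu) (d : ℤ) :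
    shiftedAdjMatrix G d *ᵥ 1 = (2 * k - d : ℤ) • 1 := by
  ext x
  rw [shiftedAdjMatrix, sub_mulVec, smul_mulVec, smul_mulVec, one_mulVec, Pi.sub_apply,
    Pi.smul_apply, SimpleGraph.adjMatrix_mulVec_apply]
  simp [hG.regular x]

/-- The square of the norm of the image of a vector under the shifted adjacency matrix. -/
lemma shiftedAdjMatrix_mulVec_dotProduct_self (hG : G.IsSRGWith v k lam mu) (x : V → ℤ) :
    (shiftedAdjMatrix G (lam - mu) *ᵥ x) ⬝ᵥ (shiftedAdjMatrix G (lam - mu) *ᵥ x) =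
      (((lam : ℤ) - mu) ^ 2 + 4 * (k - mu)) * (x ⬝ᵥ x) + 4 * mu * (1 ⬝ᵥ x) ^ 2 := by
  have h1 : (of 1 : Matrix V V ℤ) *ᵥ x = (1 ⬝ᵥ x) • 1 := by
    ext i
    simp [mulVec, dotProduct]
  have h : (shiftedAdjMatrix G (lam - mu) *ᵥ x) ᵥ* shiftedAdjMatrix G (lam - mu) =
      (((lam : ℤ) - mu) ^ 2 + 4 * (k - mu)) • x + (4 * mu * (1 ⬝ᵥ x) : ℤ) • 1 := by
    rw [← mulVec_transpose, shiftedAdjMatrix_transpose, mulVec_mulVec,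
      shiftedAdjMatrix_mul_self hG, add_mulVec, smul_mulVec, smul_mulVec, one_mulVec, h1, smul_smul]
  rw [dotProduct_mulVec, h, add_dotProduct, smul_dotProduct, smul_dotProduct, smul_eq_mul,
    smul_eq_mul]
  ring

/-- The standard relation between the parameters of a strongly regular graph, stated as a formula
for the square of the row sum of the shifted adjacency matrix. -/
lemma sq_rowSum_shiftedAdjMatrix [Nonempty V] (hG : G.IsSRGWith v k lam mu) :
    (2 * k - (lam - mu) : ℤ) ^ 2 = ((lam : ℤ) - mu) ^ 2 + 4 * (k - mu) + 4 * mu * v := by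
  have h := shiftedAdjMatrix_mulVec_dotProduct_self hG 1
  have hv : (0 : ℤ) < v := by rw [← hG.card]; exact_mod_cast Fintype.card_pos
  have h1 : (1 : V → ℤ) ⬝ᵥ 1 = v := by simp [dotProduct, ← hG.card]
  rw [shiftedAdjMatrix_mulVec_one hG, smul_dotProduct, dotProduct_smul, smul_eq_mul, smul_eq_mul,
    h1] at h
  apply mul_right_cancel₀ hv.ne'
  linear_combination h

/-- Two nonempty disjoint sets of vertices `A` and `B` of a strongly regular graph with no edges
between them are separated by at least `4|A||B|μ / ((λ - μ)² + 4(k - μ))` vertices. -/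
lemma four_mul_card_mul_card_le (hG : G.IsSRGWith v k lam mu) {A B : Finset V}
    (hA : A.Nonempty) (hB : B.Nonempty)
    (hAB : Disjoint A B) (hadj : ∀ x ∈ A, ∀ y ∈ B, ¬ G.Adj x y) :
    4 * (#A * #B * mu : ℤ) ≤ (((lam : ℤ) - mu) ^ 2 + 4 * (k - mu)) * (v - #A - #B) := by
  have : Nonempty V := ⟨hA.choose⟩
  have hK := sq_rowSum_shiftedAdjMatrix hG
  have hv : (0 : ℤ) < v := by rw [← hG.card]; exact_mod_cast Fintype.card_pos
  have ha : (0 : ℤ) < #A := by exact_mod_cast hA.card_pos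
  have hb : (0 : ℤ) < #B := by exact_mod_cast hB.card_pos
  set D : ℤ := ((lam : ℤ) - mu) ^ 2 + 4 * (k - mu)
  set K : ℤ := 2 * k - (lam - mu)
  set N := shiftedAdjMatrix G (lam - mu)
  let ind (C : Finset V) : V → ℤ := fun x => if x ∈ C then 1 else 0
  have hee : (1 : V → ℤ) ⬝ᵥ 1 = v := by simp [dotProduct, ← hG.card]
  have hec (C : Finset V) : (1 : V → ℤ) ⬝ᵥ ind C = #C := by simp [ind, dotProduct]
  have hcc (C : Finset V) : ind C ⬝ᵥ ind C = #C := by simp [ind, dotProduct]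
  have hNe : N *ᵥ 1 = K • 1 := shiftedAdjMatrix_mulVec_one hG _
  have heN : (1 : V → ℤ) ᵥ* N = K • 1 := by
    rw [← mulVec_transpose, shiftedAdjMatrix_transpose, hNe]
  have hpq : ind A ⬝ᵥ N *ᵥ ind B = 0 := by
    simp only [dotProduct, mulVec, mul_sum]
    refine sum_eq_zero fun x _ => sum_eq_zero fun y _ => ?_
    by_cases hx : x ∈ A
    · by_cases hy : y ∈ B
      · have hxy : x ≠ y := fun h => Finset.disjoint_left.mp hAB hx (h ▸ hy)
        simp [N, shiftedAdjMatrix_apply_of_ne_of_not_adj G _ hxy (hadj x hx y hy)]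
      · simp [ind, hy]
    · simp [ind, hx]
  let p : V → ℤ := (v : ℤ) • ind A - (#A : ℤ) • 1
  let q : V → ℤ := (v : ℤ) • ind B - (#B : ℤ) • 1
  have hproj (C : Finset V) : ((v : ℤ) • ind C - (#C : ℤ) • (1 : V → ℤ)) ⬝ᵥ
      ((v : ℤ) • ind C - (#C : ℤ) • (1 : V → ℤ)) = v * #C * (v - #C) := by
    simp only [sub_dotProduct, dotProduct_sub, smul_dotProduct, dotProduct_smul, smul_eq_mul,
      hee, hec, hcc, dotProduct_comm (ind C) 1]
    ring
  have hq1 : 1 ⬝ᵥ q = 0 := by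
    simp only [q, dotProduct_sub, dotProduct_smul, smul_eq_mul, hee, hec]
    ring
  have hpNq : p ⬝ᵥ N *ᵥ q = -(v * #A * #B * K) := by
    have h1 : (1 : V → ℤ) ⬝ᵥ N *ᵥ ind B = K * #B := by
      rw [dotProduct_mulVec, heN, smul_dotProduct, hec, smul_eq_mul]
    simp only [p, q, mulVec_sub, mulVec_smul, hNe, sub_dotProduct, dotProduct_sub, smul_dotProduct,
      dotProduct_smul, smul_eq_mul, hpq, hee, h1, dotProduct_comm (ind A) 1, hec]
    ring
  have hCS : (p ⬝ᵥ N *ᵥ q) ^ 2 ≤ (p ⬝ᵥ p) * ((N *ᵥ q) ⬝ᵥ (N *ᵥ q)) := by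
    simpa only [dotProduct, sq] using sum_mul_sq_le_sq_mul_sq univ p (N *ᵥ q)
  rw [hpNq, shiftedAdjMatrix_mulVec_dotProduct_self hG q, hq1, hproj A, hproj B] at hCS
  have hpos : (0 : ℤ) < v ^ 3 * #A * #B := by positivity
  refine le_of_mul_le_mul_left ?_ hpos
  linear_combination hCS - (v : ℤ) ^ 2 * #A ^ 2 * #B ^ 2 * hK

/-- If an edge has its closed neighbourhood inside `T`, then `T` has at least `2k - λ` vertices. -/
lemma two_mul_le_card_add_of_adj (hG : G.IsSRGWith v k lam mu) {T : Finset V} {x y : V}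
    (h : G.Adj x y) (hx : G.neighborFinset x ⊆ T) (hy : G.neighborFinset y ⊆ T) :
    2 * k ≤ #T + lam := by
  have h1 := card_le_card (union_subset hx hy)
  rw [hG.card_neighborFinset_union_of_adj h] at h1
  omega

end SRG

lemma exists_adj_of_reachable_ne {V : Type*} {G : SimpleGraph V} {x y : V} (hne : y ≠ x)
    (h : G.Reachable x y) : ∃ z, G.Adj x z := by
  obtain ⟨w⟩ := h
  cases w with
  | nil => exact absurd rfl hne
  | cons h _ => exact ⟨_, h⟩

/-- A good disconnecting set splits its complement into two parts, each containing an edge, with no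
edges between them. -/
lemma IsGoodDisconnectingSet.exists_separation {V : Type*} {G : SimpleGraph V} {S : Set V}
    (hS : IsGoodDisconnectingSet G S) :
    ∃ A B : Set V, A ∪ B = Sᶜ ∧ Disjoint A B ∧ (∀ x ∈ A, ∀ y ∈ B, ¬ G.Adj x y) ∧
      (∃ x ∈ A, ∃ y ∈ A, G.Adj x y) ∧ ∃ x ∈ B, ∃ y ∈ B, G.Adj x y := by
  obtain ⟨⟨u, w, huw⟩, hS⟩ := hS
  set H := G.induce Sᶜ
  refine ⟨(↑) '' {x | H.Reachable u x}, (↑) '' {x | ¬ H.Reachable u x}, ?_, ?_, ?_, ?_, ?_⟩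
  · rw [← Set.image_union]
    have h : {x | H.Reachable u x} ∪ {x | ¬ H.Reachable u x} = Set.univ := Set.union_compl_self _
    rw [h, Set.image_univ, Subtype.range_coe]
  · rw [Set.disjoint_image_iff Subtype.val_injective]
    exact Set.disjoint_left.mpr fun x hx hx' => hx' hx
  · rintro _ ⟨x, hx, rfl⟩ _ ⟨y, hy, rfl⟩ hxy
    have hxy : H.Adj x y := hxy
    exact hy (hx.trans hxy.reachable)
  · obtain ⟨z, hz, huz⟩ := hS u
    obtain ⟨y, hy⟩ := exists_adj_of_reachable_ne hz huz
    exact ⟨u, ⟨u, .refl u, rfl⟩, y, ⟨y, hy.reachable, rfl⟩, hy⟩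
  · obtain ⟨z, hz, hwz⟩ := hS w
    obtain ⟨y, hy⟩ := exists_adj_of_reachable_ne hz hwz
    exact ⟨w, ⟨w, huw, rfl⟩, y, ⟨y, fun h => huw (h.trans hy.symm.reachable), rfl⟩, hy⟩

/-- If `G` is a connected non-complete `(v,k,λ,μ)`-strongly regular graph with
`4(k − 2λ)(k − μ) > (λ − μ)²(2k − λ − 3)` (in the integers), then every good disconnecting set
`S` of `G` satisfies `|S| ≥ 2k − λ − 2`. -/
theorem brouwer_statement_2 {V : Type*} [Fintype V] (G : SimpleGraph V) [DecidableRel G.Adj]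
    (v k lam mu : ℕ) (hG : G.IsSRGWith v k lam mu)
    (hconn : G.Connected) (hnc : G ≠ ⊤)
    (hineq : ((lam : ℤ) - mu) ^ 2 * (2 * k - lam - 3) < 4 * ((k : ℤ) - 2 * lam) * ((k : ℤ) - mu))
    (S : Set V) (hS : IsGoodDisconnectingSet G S) :
    2 * (k : ℤ) - lam - 2 ≤ S.ncard := by
  classical
  have := hconn.nonempty
  by_contra! hlt
  obtain ⟨A, B, hU, hAB, hadj, ⟨x, hxA, y, hyA, hxy⟩, z, hzB, w, hwB, hzw⟩ := hS.exists_separation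
  lift A to Finset V using A.toFinite
  lift B to Finset V using B.toFinite
  lift S to Finset V using S.toFinite
  rw [Set.ncard_coe_finset] at hlt
  have hmem (t : V) : t ∈ A ∨ t ∈ B ↔ t ∉ S := by
    simpa using Set.ext_iff.mp hU t
  have hAB : Disjoint A B := by exact_mod_cast hAB
  simp only [mem_coe] at hadj hxA hyA hzB hwB
  have hcard : #A + #B + #S = v := by
    have h : A ∪ B = Sᶜ := by
      ext t
      simpa using hmem t
    rw [← card_union_of_disjoint hAB, h, add_comm, card_add_card_compl, hG.card]
  have hnA (t : V) (ht : t ∈ A) : G.neighborFinset t ⊆ A ∪ S := fun r hr => by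
    have h1 := hadj t ht r
    have h2 := hmem r
    rw [SimpleGraph.mem_neighborFinset] at hr
    rw [mem_union]
    tauto
  have hnB (t : V) (ht : t ∈ B) : G.neighborFinset t ⊆ B ∪ S := fun r hr => by
    have h1 := fun h => hadj r h t ht
    have h2 := hmem r
    rw [SimpleGraph.mem_neighborFinset, G.adj_comm] at hr
    rw [mem_union]
    tauto
  have hA := (two_mul_le_card_add_of_adj hG hxy (hnA x hxA) (hnA y hyA)).trans
    (Nat.add_le_add_right (card_union_le A S) lam)
  have hB := (two_mul_le_card_add_of_adj hG hzw (hnB z hzB) (hnB w hwB)).trans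
    (Nat.add_le_add_right (card_union_le B S) lam)
  have hA3 : (3 : ℤ) ≤ #A := by omega
  have hB3 : (3 : ℤ) ≤ #B := by omega
  have hkey := four_mul_card_mul_card_le hG ⟨x, hxA⟩ ⟨z, hzB⟩ hAB hadj
  have hK := sq_rowSum_shiftedAdjMatrix hG
  have hs : (v : ℤ) - #A - #B = #S := by omega
  rw [hs] at hkey
  have hmu : (mu : ℤ) ≤ k := by
    obtain ⟨a, b, hne, hab⟩ := SimpleGraph.ne_top_iff_exists_not_adj.mp hnc
    rw [← hG.of_not_adj hne hab, ← hG.regular a]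
    exact_mod_cast G.card_commonNeighbors_le_degree_left a b
  have hD : (0 : ℤ) ≤ ((lam : ℤ) - mu) ^ 2 + 4 * (k - mu) := by nlinarith [sq_nonneg ((lam : ℤ) - mu)]
  have h1 := mul_le_mul_of_nonneg_left (show (#S : ℤ) ≤ 2 * k - lam - 3 by omega) hD
  have h2 : (3 : ℤ) * (v - 2 * k + lam) ≤ #A * #B := by
    nlinarith [mul_nonneg (sub_nonneg.mpr hA3) (sub_nonneg.mpr hB3)]
  have h3 := mul_le_mul_of_nonneg_right h2 (Int.natCast_nonneg mu)
  linarith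

end Brouwer
end

section
/- Let G be a connected non-complete (v,k,λ,μ)-strongly regular graph with |λ − μ| ≤ 1 (i.e., λ − μ ∈ {−1, 0, 1} as integers) and k ≥ 2λ + 1. Then every good disconnecting set S of G satisfies |S| ≥ 2k − λ − 2. -/
namespace Brouwer

section StronglyRegular

open Finset

variable {V : Type*} [Fintype V] {G : SimpleGraph V} [DecidableRel G.Adj] {n k l m : ℕ}

/-- The entries of the square of the adjacency matrix of a strongly regular graph. -/
theorem sum_adjMatrix_mul_adjMatrix [DecidableEq V] (hG : G.IsSRGWith n k l m) (u w : V) :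
    ∑ z, G.adjMatrix ℤ z u * G.adjMatrix ℤ z w =
      ((k : ℤ) - m) * (if u = w then 1 else 0) + ((l : ℤ) - m) * G.adjMatrix ℤ u w + m := by
  have h := congrFun (congrFun (hG.matrix_eq (α := ℤ)) u) w
  rw [pow_two, Matrix.mul_apply, Matrix.add_apply, Matrix.add_apply, Matrix.smul_apply,
    Matrix.smul_apply, Matrix.smul_apply] at h
  calc _ = ∑ z, G.adjMatrix ℤ u z * G.adjMatrix ℤ z w := by
        simp only [SimpleGraph.adjMatrix_apply, G.adj_comm u]
    _ = _ := by
      rw [h]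
      by_cases huw : u = w
      · subst huw
        simp
      · by_cases ha : G.Adj u w <;> simp [huw, ha]

theorem sum_adjMatrix_left (hG : G.IsSRGWith n k l m) (u : V) :
    ∑ z, G.adjMatrix ℤ z u = k := by
  have h := hG.regular u
  rw [← SimpleGraph.card_neighborFinset_eq_degree, SimpleGraph.neighborFinset_eq_filter] at h
  simp [SimpleGraph.adjMatrix_apply, G.adj_comm _ u, ← h]

/-- The integral form of `SimpleGraph.IsSRGWith.param_eq`. -/
theorem srg_param_eq [Nonempty V] (hG : G.IsSRGWith n k l m) :
    (k : ℤ) * k = (k - m) + (l - m) * k + m * n := by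
  classical
  obtain ⟨w⟩ := ‹Nonempty V›
  have h : ∑ u, ∑ z, G.adjMatrix ℤ z u * G.adjMatrix ℤ z w = (k : ℤ) * k := by
    rw [sum_comm]
    simp_rw [← sum_mul]
    have hrow (z : V) : ∑ u, G.adjMatrix ℤ z u = k := by
      rw [← sum_adjMatrix_left hG z]
      simp only [SimpleGraph.adjMatrix_apply, G.adj_comm z]
    simp_rw [hrow, ← mul_sum, sum_adjMatrix_left hG]
  rw [← h]
  simp_rw [sum_adjMatrix_mul_adjMatrix hG, sum_add_distrib, ← mul_sum, sum_adjMatrix_left hG]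
  simp [hG.card]
  ring

/-- The eigenvalue bound on two sets of vertices without edges between them. -/
theorem four_mul_card_mul_card_mul_le (hG : G.IsSRGWith n k l m) {A B : Finset V}
    (hA : A.Nonempty) (hAB : Disjoint A B) (hadj : ∀ x ∈ A, ∀ y ∈ B, ¬ G.Adj y x) :
    4 * (#A * #B * m : ℤ) ≤ (((l : ℤ) - m) ^ 2 + 4 * (k - m)) * (n - #A - #B) := by
  classical
  have : Nonempty V := ⟨hA.choose⟩
  have hpar := srg_param_eq hG
  set t : ℤ := l - m with ht
  set f : V → ℤ := fun z ↦ ∑ u ∈ A, G.adjMatrix ℤ z u with hf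
  set χ : V → ℤ := fun z ↦ if z ∈ A then 1 else 0 with hχ
  set E : ℤ := ∑ z ∈ A, f z with hE
  have hsumf : ∑ z, f z = #A * k := by
    have h : ∑ z, f z = ∑ u ∈ A, ∑ z, G.adjMatrix ℤ z u := sum_comm
    rw [h, sum_congr rfl fun u _ ↦ sum_adjMatrix_left hG u, sum_const, nsmul_eq_mul]
  have hsumχ : ∑ z, χ z = #A := by simp [hχ]
  have hχχ (z : V) : χ z * χ z = χ z := by simp [hχ]
  have hfχ : ∑ z, f z * χ z = E := by simp [hχ, hE]
  have hff : ∑ z, f z * f z = (k - m) * #A + t * E + m * (#A * #A) := by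
    have h1 : ∑ z, f z * f z =
        ∑ u ∈ A, ∑ w ∈ A, ∑ z, G.adjMatrix ℤ z u * G.adjMatrix ℤ z w := by
      simp_rw [hf, sum_mul_sum]
      rw [sum_comm]
      refine sum_congr rfl fun u _ ↦ ?_
      rw [sum_comm]
    rw [h1]
    simp_rw [sum_adjMatrix_mul_adjMatrix hG, sum_add_distrib, ← mul_sum]
    rw [hE, hf]
    simp
    ring
  have hg0 : ∀ z ∈ B, 2 * f z - t * χ z = 0 := by
    intro z hz
    have h1 : f z = 0 := sum_eq_zero fun u hu ↦ by simp [hadj u hu z hz]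
    have h2 : χ z = 0 := by simp [hχ, disjoint_right.mp hAB hz]
    simp [h1, h2]
  have hcs := sq_sum_le_card_mul_sum_sq (s := Bᶜ) (f := fun z ↦ 2 * f z - t * χ z)
  have hs1 : ∑ z ∈ Bᶜ, (2 * f z - t * χ z) = ∑ z, (2 * f z - t * χ z) := by
    rw [← sum_compl_add_sum B, sum_eq_zero hg0, add_zero]
  have hs2 : ∑ z ∈ Bᶜ, (2 * f z - t * χ z) ^ 2 = ∑ z, (2 * f z - t * χ z) ^ 2 := by
    rw [← sum_compl_add_sum B, sum_eq_zero (s := B) fun z hz ↦ by rw [hg0 z hz]; norm_num, add_zero]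
  have hs3 : ∑ z, (2 * f z - t * χ z) = (2 * k - t) * #A := by
    rw [sum_sub_distrib, ← mul_sum, ← mul_sum, hsumf, hsumχ]
    ring
  have hs4 : ∑ z, (2 * f z - t * χ z) ^ 2 = (t ^ 2 + 4 * (k - m)) * #A + 4 * m * #A ^ 2 := by
    have h (z : V) : (2 * f z - t * χ z) ^ 2 =
        4 * (f z * f z) - 4 * t * (f z * χ z) + t ^ 2 * χ z := by
      linear_combination t ^ 2 * hχχ z
    simp_rw [h, sum_add_distrib, sum_sub_distrib, ← mul_sum, hff, hfχ, hsumχ]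
    ring
  have hcard : (#Bᶜ : ℤ) = n - #B := by
    rw [card_compl, hG.card, Nat.cast_sub (hG.card ▸ card_le_univ B)]
  rw [hs1, hs2, hs3, hs4, hcard] at hcs
  have hpos : (0 : ℤ) < #A := by exact_mod_cast hA.card_pos
  refine le_of_mul_le_mul_left ?_ hpos
  have hκ : (2 * k - t) ^ 2 = t ^ 2 + 4 * (k - m) + 4 * m * n := by linear_combination 4 * hpar
  rw [mul_pow, hκ] at hcs
  linarith

/-- A set containing an edge, together with a set containing all its outer neighbours, has at least
as many vertices as the closed neighbourhood of that edge. -/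
theorem two_mul_sub_le_card_add_card [DecidableEq V] (hG : G.IsSRGWith n k l m) {A T : Finset V}
    {x y : V} (hx : x ∈ A) (hy : y ∈ A) (hxy : G.Adj x y)
    (hclosed : ∀ w ∈ A, ∀ z, G.Adj w z → z ∈ A ∪ T) :
    2 * (k : ℤ) - l ≤ #A + #T := by
  have h1 : #(G.neighborFinset x ∪ G.neighborFinset y) ≤ #(A ∪ T) := by
    refine card_le_card (union_subset ?_ ?_) <;> intro z hz <;>
      rw [SimpleGraph.mem_neighborFinset] at hz
    exacts [hclosed x hx z hz, hclosed y hy z hz]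
  have h2 := card_union_le A T
  have h3 := hG.card_neighborFinset_union_of_adj hxy
  omega

/-- The numerical contradiction behind the lower bound on disconnecting sets. -/
theorem disconnecting_parameters_absurd {n k l m a b s : ℤ} (hl : 0 ≤ l) (hm : 0 ≤ m)
    (hdiff : |l - m| ≤ 1) (hk : 2 * l + 1 ≤ k)
    (hpar : k * k = (k - m) + (l - m) * k + m * n) (hn : n = a + b + s) (ha : 3 ≤ a) (hb : 3 ≤ b)
    (hs : s ≤ 2 * k - l - 3)
    (hle : 4 * (a * b * m) ≤ ((l - m) ^ 2 + 4 * (k - m)) * s) : False := by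
  have hab : 3 * (a + b - 3) ≤ a * b := by nlinarith
  have h1 : 12 * ((n - 2 * k + l) * m) ≤ 4 * (a * b * m) := by nlinarith
  have h2 : (n - 2 * k + l) * m = (k - m) * (k - l - 1) := by linear_combination -hpar
  obtain ⟨ht1, ht2⟩ := abs_le.mp hdiff
  obtain ⟨t, ht⟩ : ∃ t, t = l - m := ⟨_, rfl⟩
  obtain ⟨j, hj⟩ : ∃ j, j = k - 2 * l := ⟨_, rfl⟩
  obtain rfl : m = l - t := by omega
  obtain rfl : k = 2 * l + j := by omega
  have hD : 0 ≤ (l - (l - t)) ^ 2 + 4 * (2 * l + j - (l - t)) := by nlinarith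
  have h3 := mul_le_mul_of_nonneg_left hs hD
  rw [h2] at h1
  have hj : 1 ≤ j := by omega
  have hlj := mul_nonneg hl (sub_nonneg.mpr hj)
  have : t = -1 ∨ t = 0 ∨ t = 1 := by omega
  rcases this with rfl | rfl | rfl <;> nlinarith

end StronglyRegular

open Finset in
/-- If `G` is a connected non-complete `(v,k,λ,μ)`-strongly regular graph with
`λ − μ ∈ {−1, 0, 1}` and `k ≥ 2λ + 1`, then every good disconnecting set `S` of `G` satisfies
`|S| ≥ 2k − λ − 2`. -/
theorem brouwer_statement_3 {V : Type*} [Fintype V] (G : SimpleGraph V) [DecidableRel G.Adj]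
    (v k lam mu : ℕ) (hG : G.IsSRGWith v k lam mu)
    (hconn : G.Connected) (hnc : G ≠ ⊤)
    (hdiff : |(lam : ℤ) - mu| ≤ 1) (hk : 2 * lam + 1 ≤ k)
    (S : Set V) (hS : IsGoodDisconnectingSet G S) :
    2 * (k : ℤ) - lam - 2 ≤ S.ncard := by
  classical
  obtain ⟨⟨u, v', huv⟩, hcomp⟩ := hS
  by_contra! hlt
  set H := G.induce Sᶜ with hH
  set T : Finset V := S.toFinset with hT
  set A : Finset V := univ.filter fun w ↦ ∃ h : w ∈ Sᶜ, H.Reachable u ⟨w, h⟩ with hA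
  set B : Finset V := univ.filter fun w ↦ ∃ h : w ∈ Sᶜ, ¬ H.Reachable u ⟨w, h⟩ with hB
  have hncard : S.ncard = #T := Set.ncard_eq_toFinset_card' S
  have hreach {w z : V} (hw : w ∈ Sᶜ) (hz : z ∈ Sᶜ) (h : G.Adj w z) :
      H.Reachable ⟨w, hw⟩ ⟨z, hz⟩ :=
    SimpleGraph.Adj.reachable (G := H) (by simpa [hH] using h)
  have hclosedA : ∀ w ∈ A, ∀ z, G.Adj w z → z ∈ A ∪ T := by
    intro w hw z hwz
    obtain ⟨hwS, hw⟩ := (mem_filter.mp hw).2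
    by_cases hz : z ∈ S
    · simp [hT, hz]
    · exact mem_union_left _ (mem_filter.mpr ⟨mem_univ _, hz, hw.trans (hreach hwS hz hwz)⟩)
  have hclosedB : ∀ w ∈ B, ∀ z, G.Adj w z → z ∈ B ∪ T := by
    intro w hw z hwz
    obtain ⟨hwS, hw⟩ := (mem_filter.mp hw).2
    by_cases hz : z ∈ S
    · simp [hT, hz]
    · exact mem_union_left _ (mem_filter.mpr ⟨mem_univ _, hz,
        fun h ↦ hw (h.trans (hreach hwS hz hwz).symm)⟩)
  have hedge (w : ↑(Sᶜ)) : ∃ z : ↑(Sᶜ), H.Adj w z := by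
    obtain ⟨z, hzw, ⟨p⟩⟩ := hcomp w
    cases p with
    | nil => exact absurd rfl hzw
    | cons h _ => exact ⟨_, h⟩
  have huA : (u : V) ∈ A := mem_filter.mpr ⟨mem_univ _, u.2, .rfl⟩
  have hvB : (v' : V) ∈ B := mem_filter.mpr ⟨mem_univ _, v'.2, huv⟩
  have hAB : Disjoint A B := disjoint_left.mpr fun w hw hw' ↦
    (mem_filter.mp hw').2.2 (mem_filter.mp hw).2.2
  have hAT : Disjoint A T := disjoint_left.mpr fun w hw hw' ↦
    (mem_filter.mp hw).2.1 (by simpa [hT] using hw')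
  have hBT : Disjoint B T := disjoint_left.mpr fun w hw hw' ↦
    (mem_filter.mp hw).2.1 (by simpa [hT] using hw')
  have hadj : ∀ x ∈ A, ∀ y ∈ B, ¬ G.Adj y x := by
    intro x hx y hy h
    rcases mem_union.mp (hclosedA x hx y h.symm) with hyA | hyT
    · exact disjoint_left.mp hAB hyA hy
    · exact disjoint_left.mp hBT hy hyT
  have hcard : #A + #B + #T = v := by
    rw [← card_union_of_disjoint hAB, ← card_union_of_disjoint (disjoint_union_left.mpr ⟨hAT, hBT⟩),
      ← hG.card, ← card_univ]
    congr 1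
    refine eq_univ_of_forall fun w ↦ ?_
    by_cases hw : w ∈ S
    · simp [hT, hw]
    · by_cases h : H.Reachable u ⟨w, hw⟩
      · exact mem_union_left _ (mem_union_left _ (mem_filter.mpr ⟨mem_univ _, hw, h⟩))
      · exact mem_union_left _ (mem_union_right _ (mem_filter.mpr ⟨mem_univ _, hw, h⟩))
  have ha : 2 * (k : ℤ) - lam ≤ #A + #T := by
    obtain ⟨z, hz⟩ := hedge u
    exact two_mul_sub_le_card_add_card hG huA
      (mem_filter.mpr ⟨mem_univ (z : V), z.2, hz.reachable⟩) (by simpa [hH] using hz) hclosedA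
  have hb : 2 * (k : ℤ) - lam ≤ #B + #T := by
    obtain ⟨z, hz⟩ := hedge v'
    exact two_mul_sub_le_card_add_card hG hvB
      (mem_filter.mpr ⟨mem_univ (z : V), z.2, fun h ↦ huv (h.trans hz.reachable.symm)⟩)
      (by simpa [hH] using hz) hclosedB
  have : Nonempty V := ⟨u⟩
  have hle := four_mul_card_mul_card_mul_le hG ⟨_, huA⟩ hAB hadj
  have hv : (v : ℤ) = #A + #B + #T := by exact_mod_cast hcard.symm
  rw [show (v : ℤ) - #A - #B = #T by omega] at hle
  exact disconnecting_parameters_absurd (by positivity) (by positivity) hdiff (by omega)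
    (srg_param_eq hG) hv (by omega) (by omega) (by omega) hle

end Brouwer
end

section
/- Let G be a (v,k,λ,μ)-strongly regular graph, let s ≥ 2 be an integer, and let C be a clique of G with exactly s + 1 vertices such that every vertex not in C is adjacent to either none or at least s of the vertices of C. Then |N(C)| = 2k − λ − s − 1. -/
namespace Brouwer

/-- A vertex adjacent to all but at most one vertex of `C` is adjacent to at least one of any two
vertices of `C`. -/
theorem adj_or_adj_of_ncard_le {V : Type*} [Finite V] (G : SimpleGraph V) {s : ℕ} {C : Set V}
    (hcard : C.ncard = s + 1) {x a b : V} (hx : s ≤ {c ∈ C | G.Adj x c}.ncard)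
    (ha : a ∈ C) (hb : b ∈ C) (hab : a ≠ b) : G.Adj x a ∨ G.Adj x b := by
  by_contra! h
  have hsub : {c ∈ C | G.Adj x c} ⊆ C \ {a, b} := by
    rintro c ⟨hc, hxc⟩
    refine ⟨hc, ?_⟩
    rintro (rfl | rfl)
    exacts [h.1 hxc, h.2 hxc]
  have hpair : ({a, b} : Set V) ⊆ C := Set.pair_subset ha hb
  have hle := Set.ncard_le_ncard hsub
  have hdiff := Set.ncard_sdiff_add_ncard_of_subset hpair
  rw [Set.ncard_pair hab] at hdiff
  omega

/-- If every vertex outside a clique `C` is adjacent to none or all but at most one of its vertices,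
then the neighbors of any two vertices of `C` make up `C` together with `N(C)`. -/
theorem setNeighbors_union_eq {V : Type*} [Finite V] (G : SimpleGraph V) {s : ℕ} {C : Set V}
    (hclique : G.IsClique C) (hcard : C.ncard = s + 1)
    (hdelta : ∀ x ∉ C, {c ∈ C | G.Adj x c}.ncard = 0 ∨ s ≤ {c ∈ C | G.Adj x c}.ncard)
    {a b : V} (ha : a ∈ C) (hb : b ∈ C) (hab : a ≠ b) :
    setNeighbors G C ∪ C = G.neighborSet a ∪ G.neighborSet b := by
  ext x
  simp only [Set.mem_union, SimpleGraph.mem_neighborSet]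
  constructor
  · rintro (⟨hxC, c, hc, hxc⟩ | hxC)
    · have hne : {c ∈ C | G.Adj x c}.ncard ≠ 0 := Set.ncard_ne_zero_of_mem ⟨hc, hxc⟩
      exact (adj_or_adj_of_ncard_le G hcard ((hdelta x hxC).resolve_left hne) ha hb hab).imp
        SimpleGraph.Adj.symm SimpleGraph.Adj.symm
    · obtain rfl | hax := eq_or_ne a x
      · exact Or.inr (hclique hb hxC hab.symm)
      · exact Or.inl (hclique ha hxC hax)
  · intro hx
    by_cases hxC : x ∈ C
    · exact Or.inr hxC
    · exact Or.inl ⟨hxC, hx.elim (fun h => ⟨a, ha, h.symm⟩) (fun h => ⟨b, hb, h.symm⟩)⟩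

/-- The ends of an edge of a strongly regular graph have `2k - λ` neighbors altogether. -/
theorem ncard_neighborSet_union_add {V : Type*} [Fintype V] {G : SimpleGraph V}
    [DecidableRel G.Adj] {v k lam mu : ℕ} (hG : G.IsSRGWith v k lam mu) {a b : V}
    (hab : G.Adj a b) : (G.neighborSet a ∪ G.neighborSet b).ncard + lam = 2 * k := by
  have hdegree (x : V) : (G.neighborSet x).ncard = k := by
    rw [Set.ncard_eq_toFinset_card', Set.toFinset_card, G.card_neighborSet_eq_degree]
    exact hG.regular x
  have hcommon : (G.neighborSet a ∩ G.neighborSet b).ncard = lam := by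
    rw [← hG.of_adj a b hab, ← Nat.card_eq_fintype_card]
    rfl
  have hunion := Set.ncard_union_add_ncard_inter (G.neighborSet a) (G.neighborSet b)
  rw [hdegree, hdegree, hcommon] at hunion
  omega

/-- If `C` is a clique with `s + 1` vertices (`s ≥ 2`) in a `(v,k,λ,μ)`-strongly regular graph
such that every vertex outside `C` is adjacent to none or at least `s` of the vertices of `C`,
then `|N(C)| = 2k − λ − s − 1`. -/
theorem brouwer_statement_4 {V : Type*} [Fintype V] (G : SimpleGraph V) [DecidableRel G.Adj]
    (v k lam mu s : ℕ) (hG : G.IsSRGWith v k lam mu) (hs : 2 ≤ s)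
    (C : Set V) (hclique : G.IsClique C) (hcard : C.ncard = s + 1)
    (hdelta : ∀ x ∉ C, {c ∈ C | G.Adj x c}.ncard = 0 ∨ s ≤ {c ∈ C | G.Adj x c}.ncard) :
    ((setNeighbors G C).ncard : ℤ) = 2 * k - lam - s - 1 := by
  obtain ⟨a, ha, b, hb, hab⟩ := (Set.one_lt_ncard_iff_nontrivial (s := C)).mp (by omega)
  have hneighbors : (setNeighbors G C ∪ C).ncard + lam = 2 * k := by
    rw [setNeighbors_union_eq G hclique hcard hdelta ha hb hab]
    exact ncard_neighborSet_union_add hG (hclique ha hb hab)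
  have hdisj : Disjoint (setNeighbors G C) C :=
    Set.disjoint_left.mpr fun _ hx => hx.1
  rw [Set.ncard_union_eq hdisj] at hneighbors
  omega

end Brouwer
end

section
/- Let G be a (v,k,λ,μ)-strongly regular graph, let s ≥ 2 be an integer, and let C be a clique of G with exactly s + 1 vertices such that every vertex not in C is adjacent to either none or at least s of the vertices of C. Let x be a vertex not in C that is adjacent to no vertex of C. Then s · |N(x) ∩ N(C)| ≤ (s + 1) · μ. In particular, if (s + 1) · μ < s · k, then x has a neighbour lying outside C ∪ N(C). -/
namespace Brouwer

/-- Let `C` be a clique with `s + 1` vertices (`s ≥ 2`) in a `(v,k,λ,μ)`-strongly regular graph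
such that every vertex outside `C` is adjacent to none or at least `s` of the vertices of `C`,
and let `x ∉ C` have no neighbour in `C`. Then `s · |N(x) ∩ N(C)| ≤ (s + 1) · μ`; in particular,
if `(s + 1) · μ < s · k` then `x` has a neighbour outside `C ∪ N(C)`. -/
theorem brouwer_statement_5 {V : Type*} [Fintype V] (G : SimpleGraph V) [DecidableRel G.Adj]
    (v k lam mu s : ℕ) (hG : G.IsSRGWith v k lam mu) (hs : 2 ≤ s)
    (C : Set V) (hclique : G.IsClique C) (hcard : C.ncard = s + 1)
    (hdelta : ∀ y ∉ C, {c ∈ C | G.Adj y c}.ncard = 0 ∨ s ≤ {c ∈ C | G.Adj y c}.ncard)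
    (x : V) (hx : x ∉ C) (hxC : ∀ c ∈ C, ¬ G.Adj x c) :
    s * (G.neighborSet x ∩ setNeighbors G C).ncard ≤ (s + 1) * mu ∧
      ((s + 1) * mu < s * k → ∃ y, G.Adj x y ∧ y ∉ C ∪ setNeighbors G C) := by
  classical
  have hbound : s * (G.neighborSet x ∩ setNeighbors G C).ncard ≤ (s + 1) * mu := by
    have hcount := Finset.card_mul_le_card_mul (s := (G.neighborSet x ∩ setNeighbors G C).toFinset)
      (t := C.toFinset) (m := s) (n := mu) G.Adj ?_ ?_
    · rwa [← Set.ncard_eq_toFinset_card', ← Set.ncard_eq_toFinset_card', hcard, mul_comm] at hcount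
    · intro y hy
      obtain ⟨-, hyC, c, hc, hyc⟩ := Set.mem_toFinset.1 hy
      have habove : (Finset.bipartiteAbove G.Adj C.toFinset y : Set V) = {c ∈ C | G.Adj y c} := by
        ext; simp [Finset.bipartiteAbove]
      rw [← Set.ncard_coe_finset, habove]
      refine (hdelta y hyC).resolve_left fun h => ?_
      rw [Set.ncard_eq_zero] at h
      exact (h ▸ ⟨hc, hyc⟩ : c ∈ (∅ : Set V))
    · intro c hc
      rw [Set.mem_toFinset] at hc
      have hmu := hG.of_not_adj (fun h => hx (h ▸ hc) : x ≠ c) (hxC c hc)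
      rw [← hmu, ← Nat.card_eq_fintype_card, Nat.card_coe_set_eq, ← Set.ncard_coe_finset]
      refine Set.ncard_le_ncard fun y hy => ?_
      simp only [Finset.bipartiteBelow, Finset.coe_filter, Set.mem_toFinset, Set.mem_inter_iff,
        Set.mem_ofPred_eq, SimpleGraph.mem_neighborSet] at hy
      exact ⟨hy.1.1, hy.2.symm⟩
  refine ⟨hbound, fun hlt => ?_⟩
  by_contra! h
  have hsub : G.neighborSet x ∩ setNeighbors G C = G.neighborSet x :=
    Set.inter_eq_left.2 fun y hy => (h y hy).resolve_left fun hyC => hxC y hyC hy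
  rw [hsub, Set.ncard_eq_toFinset_card', Set.toFinset_card, SimpleGraph.card_neighborSet_eq_degree,
    hG.regular x] at hbound
  omega

end Brouwer
end

section
/- Let G be a (v,k,λ,μ)-strongly regular graph and let A be a set of vertices of G with |A| = t ≥ 3 such that the induced subgraph of G on A is connected. Then |N(A)| ≥ 2k − λ − t (as integers). -/
namespace Brouwer

/-- If `a` and `b` lie in `A`, then `N(a) ∪ N(b)` is contained in `A ∪ N(A)`. -/
theorem neighborSet_union_subset_union_setNeighbors {V : Type*} (G : SimpleGraph V) {A : Set V}
    {a b : V} (ha : a ∈ A) (hb : b ∈ A) :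
    G.neighborSet a ∪ G.neighborSet b ⊆ A ∪ setNeighbors G A := by
  intro x hx
  by_cases hxA : x ∈ A
  · exact Or.inl hxA
  · rcases hx with hx | hx
    · exact Or.inr ⟨hxA, a, ha, SimpleGraph.Adj.symm hx⟩
    · exact Or.inr ⟨hxA, b, hb, SimpleGraph.Adj.symm hx⟩

/-- If `A` is a set of `t ≥ 3` vertices of a `(v,k,λ,μ)`-strongly regular graph inducing a
connected subgraph, then `|N(A)| ≥ 2k − λ − t` (as integers). -/
theorem brouwer_statement_13 {V : Type*} [Fintype V] (G : SimpleGraph V) [DecidableRel G.Adj]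
    (v k lam mu t : ℕ) (hG : G.IsSRGWith v k lam mu)
    (A : Set V) (hA : A.ncard = t) (ht : 3 ≤ t) (hconn : (G.induce A).Connected) :
    2 * (k : ℤ) - lam - t ≤ (setNeighbors G A).ncard := by
  classical
  have hone : 1 < A.ncard := by omega
  obtain ⟨x, hx, y, hy, hxy⟩ := (Set.one_lt_ncard A.toFinite).mp hone
  have : Nontrivial A := ⟨⟨x, hx⟩, ⟨y, hy⟩, fun h => hxy (congrArg Subtype.val h)⟩
  obtain ⟨⟨b, hb⟩, hab⟩ := hconn.preconnected.exists_adj_of_nontrivial ⟨x, hx⟩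
  have hadj : G.Adj x b := hab
  have hunion : (G.neighborFinset x ∪ G.neighborFinset b).card = 2 * k - lam := by
    convert hG.card_neighborFinset_union_of_adj hadj
  have hle := Set.ncard_le_ncard (neighborSet_union_subset_union_setNeighbors G hx hb)
    (Set.toFinite _)
  have hcard : (G.neighborSet x ∪ G.neighborSet b).ncard = 2 * k - lam := by
    rw [← hunion, ← Set.ncard_coe_finset]
    simp
  have hsum := Set.ncard_union_le A (setNeighbors G A)
  omega

end Brouwer
end

section
/- Let G be a connected non-complete (v,k,λ,μ)-strongly regular graph whose second largest adjacency eigenvalue θ₂ = (λ − μ + √((λ − μ)² + 4(k − μ)))/2 satisfies θ₂ < √2. Then every good disconnecting set S of G satisfies |S| ≥ 2k − λ − 2. -/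
namespace Brouwer

open Matrix in
/-- The quadratic form of the adjacency matrix of a strongly regular graph is bounded, on vectors
orthogonal to the all-ones vector, by the second largest eigenvalue. -/
lemma two_mul_dotProduct_adjMatrix_le {V : Type*} [Fintype V] [DecidableEq V] {G : SimpleGraph V}
    [DecidableRel G.Adj] {v k lam mu : ℕ} (hG : G.IsSRGWith v k lam mu) (h : V → ℝ)
    (hsum : ∑ i, h i = 0) :
    2 * (h ⬝ᵥ G.adjMatrix ℝ *ᵥ h) ≤
      ((lam : ℝ) - mu + √(((lam : ℝ) - mu) ^ 2 + 4 * ((k : ℝ) - mu))) * (h ⬝ᵥ h) := by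
  set A := G.adjMatrix ℝ with hA
  set q := h ⬝ᵥ A *ᵥ h with hq
  set n := h ⬝ᵥ h with hn
  have hcompl : (Gᶜ).adjMatrix ℝ *ᵥ h = -h - A *ᵥ h := by
    have hones : (Matrix.of 1 : Matrix V V ℝ) *ᵥ h = 0 := by
      ext i
      simp [Matrix.mulVec, dotProduct, hsum]
    have := congrArg (· *ᵥ h) (G.one_add_adjMatrix_add_compl_adjMatrix_eq_of_one (α := ℝ))
    simp only [Matrix.add_mulVec, Matrix.one_mulVec, hones,
      SimpleGraph.compl_adjMatrix_eq_adjMatrix_compl] at this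
    rw [← sub_eq_zero, ← this]
    abel
  have hsq : (A *ᵥ h) ⬝ᵥ (A *ᵥ h) = ((lam : ℝ) - mu) * q + ((k : ℝ) - mu) * n := by
    have h1 : (A *ᵥ h) ⬝ᵥ (A *ᵥ h) = h ⬝ᵥ (A ^ 2) *ᵥ h := by
      rw [pow_two, ← Matrix.mulVec_mulVec, Matrix.dotProduct_mulVec h, ← Matrix.mulVec_transpose,
        hA, SimpleGraph.transpose_adjMatrix]
    rw [h1, hA, hG.matrix_eq]
    simp only [← Nat.cast_smul_eq_nsmul ℝ, Matrix.add_mulVec, Matrix.smul_mulVec,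
      Matrix.one_mulVec, hcompl, dotProduct_add, dotProduct_smul, dotProduct_sub, dotProduct_neg,
      smul_eq_mul]
    ring
  have hcs : q ^ 2 ≤ n * ((A *ᵥ h) ⬝ᵥ (A *ᵥ h)) := by
    simpa [hq, hn, dotProduct, pow_two] using
      Finset.sum_mul_sq_le_sq_mul_sq Finset.univ h (A *ᵥ h)
  have hn0 : 0 ≤ n := by
    simpa [hn, dotProduct] using Finset.sum_nonneg fun i _ => mul_self_nonneg (h i)
  have hbound : 2 * q - ((lam : ℝ) - mu) * n ≤
      √((((lam : ℝ) - mu) ^ 2 + 4 * ((k : ℝ) - mu)) * n ^ 2) := by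
    apply Real.le_sqrt_of_sq_le
    rw [hsq] at hcs
    nlinarith
  rw [Real.sqrt_mul' _ (sq_nonneg n), Real.sqrt_sq hn0] at hbound
  linarith

/-- The eigenvector `(1, √2, 1)` of the path on three vertices `x`, `y`, `z`. -/
noncomputable def pathVector {V : Type*} [DecidableEq V] (x y z : V) : V → ℝ :=
  Pi.single x 1 + Pi.single y (√2) + Pi.single z 1

lemma sum_pathVector {V : Type*} [Fintype V] [DecidableEq V] (x y z : V) :
    ∑ i, pathVector x y z i = 2 + √2 := by
  simp only [pathVector, Pi.add_apply, Finset.sum_add_distrib, Finset.sum_pi_single']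
  simp
  ring

open Matrix in
lemma pathVector_dotProduct_self {V : Type*} [Fintype V] [DecidableEq V] {x y z : V}
    (hxy : x ≠ y) (hyz : y ≠ z) (hxz : x ≠ z) :
    pathVector x y z ⬝ᵥ pathVector x y z = 4 := by
  simp only [pathVector, add_dotProduct, dotProduct_add, single_dotProduct]
  simp [hxy, hyz, hxz, hxy.symm, hyz.symm, hxz.symm]
  norm_num

open Matrix in
lemma pathVector_dotProduct_eq_zero {V : Type*} [Fintype V] [DecidableEq V] {P : V → Prop}
    {x y z x' y' z' : V} (hx : P x) (hy : P y) (hz : P z) (hx' : ¬ P x') (hy' : ¬ P y')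
    (hz' : ¬ P z') : pathVector x y z ⬝ᵥ pathVector x' y' z' = 0 := by
  have ne : ∀ {a b}, P a → ¬ P b → a ≠ b := fun ha hb hab => hb (hab ▸ ha)
  simp [pathVector, dotProduct_add, ne hx hx', ne hx hy', ne hx hz', ne hy hx', ne hy hy',
    ne hy hz', ne hz hx', ne hz hy', ne hz hz']

open Matrix in
lemma le_pathVector_dotProduct_adjMatrix {V : Type*} [Fintype V] [DecidableEq V]
    {G : SimpleGraph V} [DecidableRel G.Adj] {x y z : V} (hxy : G.Adj x y) (hyz : G.Adj y z) :
    4 * √2 ≤ pathVector x y z ⬝ᵥ G.adjMatrix ℝ *ᵥ pathVector x y z := by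
  simp only [pathVector, Matrix.mulVec_add, add_dotProduct, dotProduct_add, single_dotProduct,
    Matrix.mulVec_single, Pi.smul_apply, MulOpposite.smul_eq_mul_unop, MulOpposite.unop_op,
    Matrix.col_apply, SimpleGraph.adjMatrix_apply]
  by_cases hxz : G.Adj x z <;>
    simp [hxy, hyz, hxz, hxy.symm, hyz.symm, G.adj_comm z x] <;> linarith

open Matrix in
lemma pathVector_dotProduct_adjMatrix_eq_zero {V : Type*} [Fintype V] [DecidableEq V]
    {G : SimpleGraph V} [DecidableRel G.Adj] {P Q : V → Prop}
    (hPQ : ∀ a b, P a → Q b → ¬ G.Adj a b) {x y z x' y' z' : V}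
    (hx : P x) (hy : P y) (hz : P z) (hx' : Q x') (hy' : Q y') (hz' : Q z') :
    pathVector x y z ⬝ᵥ G.adjMatrix ℝ *ᵥ pathVector x' y' z' = 0 := by
  simp only [pathVector, Matrix.mulVec_add, add_dotProduct, dotProduct_add, single_dotProduct,
    Matrix.mulVec_single, Pi.smul_apply, MulOpposite.smul_eq_mul_unop, MulOpposite.unop_op,
    Matrix.col_apply, SimpleGraph.adjMatrix_apply]
  simp [hPQ _ _ hx hx', hPQ _ _ hx hy', hPQ _ _ hx hz', hPQ _ _ hy hx', hPQ _ _ hy hy',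
    hPQ _ _ hy hz', hPQ _ _ hz hx', hPQ _ _ hz hy', hPQ _ _ hz hz']

open Matrix in
/-- A strongly regular graph with second largest eigenvalue less than `√2` does not contain two
paths on three vertices that are disjoint and have no edge between them. -/
lemma not_separated_paths {V : Type*} [Fintype V] {G : SimpleGraph V} [DecidableRel G.Adj]
    {v k lam mu : ℕ} (hG : G.IsSRGWith v k lam mu)
    (htheta : (lam : ℝ) - mu + √(((lam : ℝ) - mu) ^ 2 + 4 * ((k : ℝ) - mu)) < 2 * √2)
    {P Q : V → Prop} (hdisj : ∀ a, P a → ¬ Q a) (hPQ : ∀ a b, P a → Q b → ¬ G.Adj a b)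
    {x y z x' y' z' : V} (hx : P x) (hy : P y) (hz : P z) (hx' : Q x') (hy' : Q y') (hz' : Q z')
    (hxy : G.Adj x y) (hyz : G.Adj y z) (hxz : x ≠ z)
    (hxy' : G.Adj x' y') (hyz' : G.Adj y' z') (hxz' : x' ≠ z') : False := by
  classical
  have hQP : ∀ a, Q a → ¬ P a := fun a hq hp => hdisj a hp hq
  have key := two_mul_dotProduct_adjMatrix_le hG (pathVector x y z - pathVector x' y' z') (by
    simp only [Pi.sub_apply, Finset.sum_sub_distrib, sum_pathVector, sub_self])
  simp only [Matrix.mulVec_sub, sub_dotProduct, dotProduct_sub,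
    pathVector_dotProduct_self hxy.ne hyz.ne hxz,
    pathVector_dotProduct_self hxy'.ne hyz'.ne hxz',
    pathVector_dotProduct_eq_zero hx hy hz (hQP _ hx') (hQP _ hy') (hQP _ hz'),
    pathVector_dotProduct_eq_zero hx' hy' hz' (hdisj _ hx) (hdisj _ hy) (hdisj _ hz),
    pathVector_dotProduct_adjMatrix_eq_zero hPQ hx hy hz hx' hy' hz',
    pathVector_dotProduct_adjMatrix_eq_zero (fun a b ha hb hab => hPQ b a hb ha hab.symm)
      hx' hy' hz' hx hy hz] at key
  have h1 := le_pathVector_dotProduct_adjMatrix hxy hyz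
  have h2 := le_pathVector_dotProduct_adjMatrix hxy' hyz'
  linarith

/-- The component of a non-isolated vertex is either a single edge or contains a path on three
vertices. -/
lemma exists_isolated_edge_or_path {W : Type*} {H : SimpleGraph W} {u w : W} (hne : w ≠ u)
    (hr : H.Reachable u w) :
    (∃ a b, H.Adj a b ∧ (∀ c, H.Adj a c → c = b) ∧ ∀ c, H.Adj b c → c = a) ∨
    ∃ x y z, H.Adj x y ∧ H.Adj y z ∧ x ≠ z ∧
      H.Reachable u x ∧ H.Reachable u y ∧ H.Reachable u z := by
  obtain ⟨p⟩ := hr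
  cases p with
  | nil => exact absurd rfl hne
  | @cons _ y _ huy _ =>
    by_cases hu : ∀ c, H.Adj u c → c = y
    · by_cases hy : ∀ c, H.Adj y c → c = u
      · exact .inl ⟨u, y, huy, hu, hy⟩
      · push Not at hy
        obtain ⟨z, hyz, hzu⟩ := hy
        exact .inr ⟨u, y, z, huy, hyz, hzu.symm, .rfl, huy.reachable,
          huy.reachable.trans hyz.reachable⟩
    · push Not at hu
      obtain ⟨z, huz, hzy⟩ := hu
      exact .inr ⟨z, u, y, huz.symm, huy, hzy, huz.reachable, .rfl, huy.reachable⟩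

/-- If both ends of an edge have all their other neighbours in `S`, then `|S| ≥ 2k − λ − 2`. -/
lemma le_ncard_of_edge {V : Type*} [Fintype V] {G : SimpleGraph V} [DecidableRel G.Adj]
    {v k lam mu : ℕ} (hG : G.IsSRGWith v k lam mu) {S : Set V} {a b : V} (hab : G.Adj a b)
    (ha : ∀ c, G.Adj a c → c ∉ S → c = b) (hb : ∀ c, G.Adj b c → c ∉ S → c = a) :
    2 * (k : ℤ) - lam - 2 ≤ S.ncard := by
  classical
  have hsub : G.neighborFinset a ∪ G.neighborFinset b ⊆ S.toFinset ∪ {a, b} := by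
    intro c hc
    simp only [Finset.mem_union, SimpleGraph.mem_neighborFinset, Set.mem_toFinset,
      Finset.mem_insert, Finset.mem_singleton] at hc ⊢
    by_cases hcS : c ∈ S
    · exact .inl hcS
    · exact .inr (hc.elim (fun h => .inr (ha c h hcS)) fun h => .inl (hb c h hcS))
  have hle := (Finset.card_le_card hsub).trans (Finset.card_union_le _ _)
  have hinter : (G.neighborFinset a ∩ G.neighborFinset b).card = lam := by
    rw [← hG.of_adj a b hab, ← Set.toFinset_card]
    congr 1
    ext c
    simp [SimpleGraph.mem_commonNeighbors]
  have hunion := Finset.card_union_add_card_inter (G.neighborFinset a) (G.neighborFinset b)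
  have hda : (G.neighborFinset a).card = k := hG.regular a
  have hdb : (G.neighborFinset b).card = k := hG.regular b
  have hpair := Finset.card_le_two (a := a) (b := b)
  rw [Set.ncard_eq_toFinset_card']
  omega

/-- If `G` is a connected non-complete `(v,k,λ,μ)`-strongly regular graph whose second largest
eigenvalue `θ₂ = (λ − μ + √((λ − μ)² + 4(k − μ)))/2` satisfies `θ₂ < √2`, then every good
disconnecting set `S` of `G` satisfies `|S| ≥ 2k − λ − 2`. -/
theorem brouwer_statement_16 {V : Type*} [Fintype V] (G : SimpleGraph V) [DecidableRel G.Adj]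
    (v k lam mu : ℕ) (hG : G.IsSRGWith v k lam mu)
    (hconn : G.Connected) (hnc : G ≠ ⊤)
    (htheta : (lam : ℝ) - mu + Real.sqrt (((lam : ℝ) - mu) ^ 2 + 4 * ((k : ℝ) - mu)) <
      2 * Real.sqrt 2)
    (S : Set V) (hS : IsGoodDisconnectingSet G S) :
    2 * (k : ℤ) - lam - 2 ≤ S.ncard := by
  obtain ⟨⟨u, w, huw⟩, hcomp⟩ := hS
  have hedge : ∀ {a b : ↑Sᶜ}, (G.induce Sᶜ).Adj a b → (∀ c, (G.induce Sᶜ).Adj a c → c = b) →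
      (∀ c, (G.induce Sᶜ).Adj b c → c = a) → 2 * (k : ℤ) - lam - 2 ≤ S.ncard :=
    fun hab ha hb => le_ncard_of_edge hG (SimpleGraph.induce_adj.1 hab)
      (fun c hc hcS => congrArg Subtype.val (ha ⟨c, hcS⟩ hc))
      (fun c hc hcS => congrArg Subtype.val (hb ⟨c, hcS⟩ hc))
  obtain ⟨u', hne, hr⟩ := hcomp u
  obtain ⟨w', hne', hr'⟩ := hcomp w
  obtain ⟨a, b, hab, ha, hb⟩ | ⟨x, y, z, hxy, hyz, hxz, hx, hy, hz⟩ :=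
    exists_isolated_edge_or_path hne hr
  · exact hedge hab ha hb
  obtain ⟨a, b, hab, ha, hb⟩ | ⟨x', y', z', hxy', hyz', hxz', hx', hy', hz'⟩ :=
    exists_isolated_edge_or_path hne' hr'
  · exact hedge hab ha hb
  refine (not_separated_paths hG htheta
    (P := fun c => ∃ hc : c ∈ Sᶜ, (G.induce Sᶜ).Reachable u ⟨c, hc⟩)
    (Q := fun c => ∃ hc : c ∈ Sᶜ, (G.induce Sᶜ).Reachable w ⟨c, hc⟩) ?_ ?_
    ⟨x.2, hx⟩ ⟨y.2, hy⟩ ⟨z.2, hz⟩ ⟨x'.2, hx'⟩ ⟨y'.2, hy'⟩ ⟨z'.2, hz'⟩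
    hxy hyz (Subtype.coe_injective.ne hxz) hxy' hyz' (Subtype.coe_injective.ne hxz')).elim
  · rintro c ⟨_, h⟩ ⟨_, h'⟩
    exact huw (h.trans h'.symm)
  · rintro c d ⟨hc, h⟩ ⟨hd, h'⟩ hcd
    have hcd' : (G.induce Sᶜ).Adj ⟨c, hc⟩ ⟨d, hd⟩ := hcd
    exact huw ((h.trans hcd'.reachable).trans h'.symm)

end Brouwer
end

section
/- Let G be a (26,15,8,9)-strongly regular graph. Then every good disconnecting set S of G satisfies |S| ≥ 20. -/
namespace Brouwer

section FinsetCounting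

variable {α : Type*} [DecidableEq α]

/-- Inclusion-exclusion inside `X` for three sets with the same pairwise intersection `B`. -/
theorem card_inter_union_of_common_inter {X N₁ N₂ N₃ B : Finset α}
    (h₁₂ : N₁ ∩ N₂ = B) (h₁₃ : N₁ ∩ N₃ = B) (h₂₃ : N₂ ∩ N₃ = B) :
    (X ∩ (N₁ ∪ (N₂ ∪ N₃))).card + 2 * (X ∩ B).card =
      (X ∩ N₁).card + (X ∩ N₂).card + (X ∩ N₃).card := by
  have h := Finset.card_union_add_card_inter (X ∩ N₂) (X ∩ N₃)
  have h' := Finset.card_union_add_card_inter (X ∩ N₁) (X ∩ (N₂ ∪ N₃))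
  rw [← Finset.inter_union_distrib_left, ← Finset.inter_inter_distrib_left] at h h'
  rw [h₂₃] at h
  rw [Finset.inter_union_distrib_left N₁, h₁₂, h₁₃, Finset.union_self] at h'
  omega

end FinsetCounting

section StronglyRegular

variable {V : Type*} [Fintype V] [DecidableEq V] {H : SimpleGraph V} [DecidableRel H.Adj]
  {n k l m : ℕ}

theorem card_inter_neighborFinset_of_adj (hH : H.IsSRGWith n k l m) {x y : V}
    (h : H.Adj x y) : (H.neighborFinset x ∩ H.neighborFinset y).card = l := by
  rw [← hH.of_adj x y h, ← Set.toFinset_card]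
  congr 1
  ext
  simp [SimpleGraph.mem_commonNeighbors]

theorem card_inter_neighborFinset_of_not_adj (hH : H.IsSRGWith n k l m) {x y : V}
    (hne : x ≠ y) (h : ¬ H.Adj x y) :
    (H.neighborFinset x ∩ H.neighborFinset y).card = m := by
  rw [← hH.of_not_adj hne h, ← Set.toFinset_card]
  congr 1
  ext
  simp [SimpleGraph.mem_commonNeighbors]

theorem subset_inter_neighborFinset {B : Finset V} {x y : V}
    (hx : ∀ b ∈ B, H.Adj x b) (hy : ∀ b ∈ B, H.Adj y b) :
    B ⊆ H.neighborFinset x ∩ H.neighborFinset y := fun b hb => by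
  simp [hx b hb, hy b hb]

/-- When `l < m`, two vertices with `m` known common neighbours are nonadjacent and have no
further common neighbours. -/
theorem not_adj_and_inter_eq_of_card_eq (hH : H.IsSRGWith n k l m) (hlm : l < m)
    {B : Finset V} (hB : B.card = m) {x y : V} (hne : x ≠ y)
    (hx : ∀ b ∈ B, H.Adj x b) (hy : ∀ b ∈ B, H.Adj y b) :
    ¬ H.Adj x y ∧ H.neighborFinset x ∩ H.neighborFinset y = B := by
  have hsub := subset_inter_neighborFinset hx hy
  have hnot : ¬ H.Adj x y := fun h => by
    have := Finset.card_le_card hsub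
    rw [card_inter_neighborFinset_of_adj hH h] at this
    omega
  refine ⟨hnot, (Finset.eq_of_subset_of_card_le hsub ?_).symm⟩
  rw [card_inter_neighborFinset_of_not_adj hH hne hnot, hB]

/-- A `(26,10,3,4)`-strongly regular graph contains no `K_{3,4}`. -/
theorem no_completeBipartite_three_four (hH : H.IsSRGWith 26 10 3 4) {A B : Finset V}
    (hA : A.card = 3) (hB : B.card = 4) (hAB : ∀ a ∈ A, ∀ b ∈ B, H.Adj a b) : False := by
  obtain ⟨a₁, a₂, a₃, h₁₂, h₁₃, h₂₃, rfl⟩ := Finset.card_eq_three.mp hA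
  have hb₁ : ∀ b ∈ B, H.Adj a₁ b := hAB a₁ (by simp)
  have hb₂ : ∀ b ∈ B, H.Adj a₂ b := hAB a₂ (by simp)
  have hb₃ : ∀ b ∈ B, H.Adj a₃ b := hAB a₃ (by simp)
  obtain ⟨n₁₂, i₁₂⟩ := not_adj_and_inter_eq_of_card_eq hH (by norm_num) hB h₁₂ hb₁ hb₂
  obtain ⟨n₁₃, i₁₃⟩ := not_adj_and_inter_eq_of_card_eq hH (by norm_num) hB h₁₃ hb₁ hb₃
  obtain ⟨n₂₃, i₂₃⟩ := not_adj_and_inter_eq_of_card_eq hH (by norm_num) hB h₂₃ hb₂ hb₃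
  have hcount (X : Finset V) := card_inter_union_of_common_inter (X := X) i₁₂ i₁₃ i₂₃
  set U := H.neighborFinset a₁ ∪ (H.neighborFinset a₂ ∪ H.neighborFinset a₃) with hU
  have hdeg (x : V) : (H.neighborFinset x).card = 10 := hH.regular x
  have hUc : Uᶜ.card = 4 := by
    have h := hcount Finset.univ
    simp only [Finset.univ_inter, hdeg, hB] at h
    rw [Finset.card_compl, hH.card]
    omega
  have hAU : ({a₁, a₂, a₃} : Finset V) ⊆ Uᶜ := by
    intro x hx
    simp only [Finset.mem_insert, Finset.mem_singleton] at hx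
    rcases hx with rfl | rfl | rfl <;>
      simp [U, n₁₂, n₁₃, n₂₃,
        mt SimpleGraph.Adj.symm n₁₂, mt SimpleGraph.Adj.symm n₁₃, mt SimpleGraph.Adj.symm n₂₃]
  -- The unique vertex outside `A` that is nonadjacent to all of `A`.
  obtain ⟨w, hw⟩ : ∃ w, Uᶜ \ {a₁, a₂, a₃} = {w} := by
    rw [← Finset.card_eq_one, Finset.card_sdiff_of_subset hAU, hUc, hA]
  have hwU : w ∈ Uᶜ \ {a₁, a₂, a₃} := by simp [hw]
  have hUw : Uᶜ = insert w {a₁, a₂, a₃} := by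
    rw [← Finset.sdiff_union_of_subset hAU, hw, Finset.singleton_union]
  simp only [Finset.mem_sdiff, Finset.mem_compl, hU, Finset.mem_union, Finset.mem_insert,
    Finset.mem_singleton, SimpleGraph.mem_neighborFinset, not_or] at hwU
  obtain ⟨⟨m₁, m₂, m₃⟩, e₁, e₂, e₃⟩ := hwU
  have hwB : ∀ b ∈ B, ¬ H.Adj w b := by
    intro b hb hwb
    have hsub : Uᶜ ⊆ H.neighborFinset b := by
      rw [hUw]
      intro x hx
      simp only [Finset.mem_insert, Finset.mem_singleton] at hx
      rw [SimpleGraph.mem_neighborFinset, H.adj_comm]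
      rcases hx with rfl | rfl | rfl | rfl
      exacts [hwb, hb₁ b hb, hb₂ b hb, hb₃ b hb]
    have hcb := hcount (H.neighborFinset b)
    rw [card_inter_neighborFinset_of_adj hH (hb₁ b hb).symm,
      card_inter_neighborFinset_of_adj hH (hb₂ b hb).symm,
      card_inter_neighborFinset_of_adj hH (hb₃ b hb).symm] at hcb
    have hsplit := Finset.card_inter_add_card_sdiff (H.neighborFinset b) U
    rw [Finset.sdiff_eq_inter_compl, Finset.inter_eq_right.mpr hsub, hUc, hdeg] at hsplit
    omega
  have hw0 : H.neighborFinset w ∩ B = ∅ := by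
    ext x
    simpa using fun hx hxB => hwB x hxB hx
  have hcw := hcount (H.neighborFinset w)
  rw [hw0, card_inter_neighborFinset_of_not_adj hH e₁ (fun h => m₁ h.symm),
    card_inter_neighborFinset_of_not_adj hH e₂ (fun h => m₂ h.symm),
    card_inter_neighborFinset_of_not_adj hH e₃ (fun h => m₃ h.symm), Finset.card_empty] at hcw
  have := Finset.card_le_card (Finset.inter_subset_left (s₁ := H.neighborFinset w) (s₂ := U))
  rw [hdeg] at this
  omega

theorem card_le_four_of_pair (hH : H.IsSRGWith 26 10 3 4) {B : Finset V} {x y : V}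
    (hne : x ≠ y) (hx : ∀ b ∈ B, H.Adj x b) (hy : ∀ b ∈ B, H.Adj y b) : B.card ≤ 4 := by
  have h := Finset.card_le_card (subset_inter_neighborFinset hx hy)
  by_cases hxy : H.Adj x y
  · rw [card_inter_neighborFinset_of_adj hH hxy] at h
    omega
  · rwa [card_inter_neighborFinset_of_not_adj hH hne hxy] at h

/-- In a `(26,10,3,4)`-strongly regular graph, a complete bipartite subgraph with at least two
vertices on either side has at most six vertices. -/
theorem card_add_card_le_six_of_completeBipartite (hH : H.IsSRGWith 26 10 3 4)
    {A B : Finset V} (hA : 1 < A.card) (hB : 1 < B.card)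
    (hAB : ∀ a ∈ A, ∀ b ∈ B, H.Adj a b) : A.card + B.card ≤ 6 := by
  obtain ⟨a, ha, a', ha', hne⟩ := Finset.one_lt_card.mp hA
  obtain ⟨b, hb, b', hb', hne'⟩ := Finset.one_lt_card.mp hB
  have hB4 := card_le_four_of_pair hH hne (hAB a ha) (hAB a' ha')
  have hA4 := card_le_four_of_pair hH hne' (fun x hx => (hAB x hx b hb).symm)
    (fun x hx => (hAB x hx b' hb').symm)
  by_contra! hcon
  obtain h | h : (3 ≤ A.card ∧ B.card = 4) ∨ (3 ≤ B.card ∧ A.card = 4) := by omega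
  · obtain ⟨A', hsub, hcard⟩ := Finset.exists_subset_card_eq h.1
    exact no_completeBipartite_three_four hH hcard h.2 fun x hx => hAB x (hsub hx)
  · obtain ⟨B', hsub, hcard⟩ := Finset.exists_subset_card_eq h.1
    exact no_completeBipartite_three_four hH hcard h.2
      fun y hy x hx => (hAB x hx y (hsub hy)).symm

end StronglyRegular

/-- The complement of a good disconnecting set splits into two parts of size at least two with no
edges between them. -/
theorem IsGoodDisconnectingSet.exists_partition {V : Type*} [Fintype V] [DecidableEq V]
    {G : SimpleGraph V} {S : Set V} (hS : IsGoodDisconnectingSet G S) :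
    ∃ A B : Finset V, Disjoint A B ∧ (↑(A ∪ B) : Set V) = Sᶜ ∧ 1 < A.card ∧ 1 < B.card ∧
      ∀ a ∈ A, ∀ b ∈ B, Gᶜ.Adj a b := by
  classical
  obtain ⟨⟨u, v, huv⟩, hcomp⟩ := hS
  let P : ↑(Sᶜ) → Prop := (G.induce Sᶜ).Reachable u
  let A : Finset V := (Finset.univ.filter P).map (Function.Embedding.subtype _)
  let B : Finset V := (Finset.univ.filter (fun x => ¬ P x)).map (Function.Embedding.subtype _)
  refine ⟨A, B, ?_, ?_, ?_, ?_, ?_⟩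
  · rw [Finset.disjoint_map]
    exact Finset.disjoint_filter_filter_not _ _ _
  · rw [← Finset.map_union, Finset.filter_union_filter_not_eq]
    ext
    simp
  · obtain ⟨w, hwu, hw⟩ := hcomp u
    rw [Finset.card_map, Finset.one_lt_card]
    exact ⟨u, by simp [P], w, by simp [P, hw], hwu.symm⟩
  · obtain ⟨w, hwv, hw⟩ := hcomp v
    rw [Finset.card_map, Finset.one_lt_card]
    exact ⟨v, by simp [P, huv], w, by simpa [P] using fun h => huv (h.trans hw.symm), hwv.symm⟩
  · intro a ha b hb
    obtain ⟨x, hx, rfl⟩ := Finset.mem_map.mp ha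
    obtain ⟨y, hy, rfl⟩ := Finset.mem_map.mp hb
    have hx' : P x := (Finset.mem_filter.mp hx).2
    have hy' : ¬ P y := (Finset.mem_filter.mp hy).2
    refine (SimpleGraph.compl_adj _ _ _).mpr ⟨fun h => hy' ?_, fun h => hy' ?_⟩
    · exact Subtype.ext h ▸ hx'
    · exact hx'.trans (SimpleGraph.Adj.reachable (G := G.induce Sᶜ) h)

/-- Every good disconnecting set `S` of a `(26,15,8,9)`-strongly regular graph satisfies
`|S| ≥ 20`. -/
theorem brouwer_statement_17 {V : Type*} [Fintype V] (G : SimpleGraph V) [DecidableRel G.Adj]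
    (hG : G.IsSRGWith 26 15 8 9)
    (S : Set V) (hS : IsGoodDisconnectingSet G S) :
    20 ≤ S.ncard := by
  classical
  obtain ⟨A, B, hdisj, hunion, hA, hB, hAB⟩ := hS.exists_partition
  have hle := card_add_card_le_six_of_completeBipartite hG.compl hA hB hAB
  have hcard := Set.ncard_add_ncard_compl S
  rw [← hunion, Set.ncard_coe_finset, Finset.card_union_of_disjoint hdisj,
    Nat.card_eq_fintype_card, hG.card] at hcard
  omega

end Brouwer
end
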